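/- Every injective continuous self-map of a compact connected topological manifold is surjective: if M is a compact, connected, Hausdorff topological space that is locally homeomorphic to ℝⁿ, and f : M → M is continuous and injective, then f is surjective. -/

import Mathlib

section InvarianceOfDomain

open MeasureTheory Metric Set Topology

theorem ContinuousLinearMap.exists_polynomial_eval_eq_det_one_add_smul {E : Type*}
    [NormedAddCommGroup E] [NormedSpace ℝ E] [FiniteDimensional ℝ E] (A : E →L[ℝ] E) :
    ∃ p : Polynomial ℝ, p.natDegree ≤ Module.finrank ℝ E ∧
      ∀ t : ℝ, p.eval t = (1 + t • A).det := by
  let b := Module.finBasis ℝ E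
  let M : Matrix (Fin (Module.finrank ℝ E)) (Fin (Module.finrank ℝ E)) ℝ :=
    LinearMap.toMatrix b b (A : E →ₗ[ℝ] E)
  refine ⟨((Polynomial.X : Polynomial ℝ) • M.map Polynomial.C +
    (1 : Matrix (Fin (Module.finrank ℝ E)) (Fin (Module.finrank ℝ E)) ℝ).map Polynomial.C).det,
    ?_, fun t => ?_⟩
  · simpa using Polynomial.natDegree_det_X_add_C_le M 1
  · rw [ContinuousLinearMap.det, ← LinearMap.det_toMatrix b, ← Polynomial.coe_evalRingHom,
      RingHom.map_det]
    congr 1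
    ext i j
    by_cases hij : i = j <;>
      simp [M, hij, LinearMap.toMatrix_apply, add_comm, mul_comm t]

/-- The integral of `det (1 + t • A x)` is a polynomial in `t`, hence constant as soon as it is
constant for small positive `t`. -/
theorem MeasureTheory.setIntegral_det_one_add_smul_eq_of_forall_small {E : Type*}
    [NormedAddCommGroup E] [NormedSpace ℝ E] [FiniteDimensional ℝ E] [MeasurableSpace E]
    {μ : Measure E} {s : Set E} {A : E → E →L[ℝ] E}
    (hA : ∀ t : ℝ, IntegrableOn (fun x => (1 + t • A x).det) s μ) {c T : ℝ} (hT : 0 < T)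
    (h : ∀ t : ℝ, 0 < t → t < T → ∫ x in s, (1 + t • A x).det ∂μ = c) (t : ℝ) :
    ∫ x in s, (1 + t • A x).det ∂μ = c := by
  let N := Finset.range (Module.finrank ℝ E + 1)
  let v : ℕ → ℝ := fun i => T / (i + 2)
  have hv : Set.InjOn v N := by
    intro i _ j _ hij
    have hi : (i : ℝ) + 2 ≠ 0 := by positivity
    have hj : (j : ℝ) + 2 ≠ 0 := by positivity
    simp only [v] at hij
    field_simp at hij
    exact_mod_cast (add_right_cancel hij).symm
  have hexp : ∀ x, (1 + t • A x).det =
      ∑ i ∈ N, (1 + v i • A x).det * (Lagrange.basis N v i).eval t := by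
    intro x
    obtain ⟨p, hp, hpe⟩ := (A x).exists_polynomial_eval_eq_det_one_add_smul
    have hdeg : p.degree < N.card := by
      refine (Polynomial.degree_le_of_natDegree_le hp).trans_lt ?_
      simp only [N, Finset.card_range]
      exact_mod_cast Nat.lt_succ_self _
    have := congrArg (Polynomial.eval t) (Lagrange.eq_interpolate hv hdeg)
    simpa [Lagrange.interpolate_apply, Polynomial.eval_finsetSum, hpe] using this
  have hsum : ∑ i ∈ N, (Lagrange.basis N v i).eval t = 1 := by
    rw [← Polynomial.eval_finsetSum, Lagrange.sum_basis hv ⟨0, by simp [N]⟩, Polynomial.eval_one]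
  have hnode : ∀ i, ∫ x in s, (1 + v i • A x).det ∂μ = c := fun i => by
    refine h _ (by positivity) ?_
    rw [div_lt_iff₀ (by positivity)]
    nlinarith [(Nat.cast_nonneg i : (0 : ℝ) ≤ i)]
  simp_rw [hexp]
  rw [integral_finsetSum _ fun i _ => (hA (v i)).mul_const _]
  simp_rw [integral_mul_const, hnode, ← Finset.mul_sum, hsum, mul_one]

theorem LipschitzOnWith.indicator_closedBall {E F : Type*} [NormedAddCommGroup E] [NormedSpace ℝ E]
    [NormedAddCommGroup F] {g : E → F} {K : NNReal}
    (hg : LipschitzOnWith K g (closedBall 0 1)) (h0 : ∀ x, ‖x‖ = 1 → g x = 0) :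
    LipschitzWith K ((closedBall 0 1).indicator g) := by
  have key : ∀ x y : E, ‖x‖ ≤ 1 → 1 < ‖y‖ → ‖g x‖ ≤ K * ‖x - y‖ := by
    intro x y hx hy
    have hcont : Continuous fun s : ℝ => ‖x + s • (y - x)‖ := by fun_prop
    obtain ⟨s, hs, hs1⟩ := intermediate_value_Icc zero_le_one hcont.continuousOn
      (show (1 : ℝ) ∈ _ by simpa using ⟨hx, hy.le⟩)
    have hz := hg.norm_sub_le (mem_closedBall_zero_iff.2 hx) (mem_closedBall_zero_iff.2 hs1.le)
    rw [h0 _ hs1, sub_zero, sub_add_cancel_left, norm_neg, norm_smul, norm_sub_rev y,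
      Real.norm_of_nonneg hs.1] at hz
    refine hz.trans ?_
    gcongr
    exact mul_le_of_le_one_left (norm_nonneg _) hs.2
  refine LipschitzWith.of_dist_le_mul fun x y => ?_
  rw [dist_eq_norm, dist_eq_norm]
  rcases le_or_gt ‖x‖ 1 with hx | hx <;> rcases le_or_gt ‖y‖ 1 with hy | hy
  · simpa [Set.indicator, hx, hy] using
      hg.norm_sub_le (mem_closedBall_zero_iff.2 hx) (mem_closedBall_zero_iff.2 hy)
  · simpa [Set.indicator, hx, hy.not_ge] using key x y hx hy
  · simpa [Set.indicator, hx.not_ge, hy, norm_sub_rev y] using key y x hy hx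
  · simp only [Set.indicator, mem_closedBall_zero_iff, hx.not_ge, hy.not_ge]
    simp only [if_false, sub_self, norm_zero]
    positivity

/-- A perturbation of the identity by a small Lipschitz map supported in a set is injective and
preserves the set. -/
theorem LipschitzWith.injective_and_image_eq_of_id_add {E : Type*} [NormedAddCommGroup E]
    [NormedSpace ℝ E] [CompleteSpace E] {g : E → E} {K : NNReal} (hg : LipschitzWith K g)
    (hK : K < 1) {s : Set E} (h0 : ∀ x ∉ s, g x = 0) :
    Function.Injective (fun x => x + g x) ∧ (fun x => x + g x) '' s = s := by
  have happ : ApproximatesLinearOn (fun x => x + g x)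
      (ContinuousLinearEquiv.refl ℝ E : E →L[ℝ] E) univ K :=
    fun x _ y _ => by
      simpa [add_sub_add_comm] using hg.norm_sub_le x y
  have hc : Subsingleton E ∨
      K < ‖((ContinuousLinearEquiv.refl ℝ E).symm : E →L[ℝ] E)‖₊⁻¹ := by
    rcases subsingleton_or_nontrivial E with h | h
    · exact Or.inl h
    · right
      have h1 : ‖((ContinuousLinearEquiv.refl ℝ E).symm : E →L[ℝ] E)‖₊ = 1 :=
        NNReal.eq ContinuousLinearMap.norm_id
      rwa [h1, inv_one]
  have hbij : Function.Bijective (fun x => x + g x) := (happ.toHomeomorph _ hc).bijective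
  refine ⟨hbij.1, compl_injective ?_⟩
  rw [← image_compl_eq hbij]
  have : EqOn (fun x => x + g x) id sᶜ := fun x hx => by simp [h0 x hx]
  rw [this.image_eq, image_id]

variable {E : Type*} [NormedAddCommGroup E] [InnerProductSpace ℝ E] [FiniteDimensional ℝ E]

theorem HasFDerivAt.det_eq_zero_of_eventually_norm_eq_one {r : E → E} {r' : E →L[ℝ] E} {x : E}
    (hr : HasFDerivAt r r' x) (h1 : ∀ᶠ y in 𝓝 x, ‖r y‖ = 1) : r'.det = 0 := by
  by_contra hdet
  have hsurj : Function.Surjective r' := by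
    have := (LinearMap.isUnit_iff_isUnit_det (r' : E →ₗ[ℝ] E)).2 (isUnit_iff_ne_zero.2 hdet)
    exact ((Module.End.isUnit_iff _).1 this).2
  obtain ⟨v, hv⟩ := hsurj (r x)
  have h2 : HasFDerivAt (fun y => ‖r y‖ ^ 2) (2 • (innerSL ℝ (r x)).comp r') x := hr.norm_sq
  have h3 : HasFDerivAt (fun y => ‖r y‖ ^ 2) (0 : E →L[ℝ] ℝ) x :=
    (hasFDerivAt_const (1 : ℝ) x).congr_of_eventuallyEq (h1.mono fun y hy => by simp [hy])
  have h4 := DFunLike.congr_fun (h2.unique h3) v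
  simp [hv, h1.self_of_nhds] at h4

/-- There is no `C¹` retraction of the closed unit ball onto the unit sphere. -/
theorem not_forall_contDiffAt_retraction_sphere {r : E → E}
    (hr : ∀ x, ‖x‖ ≤ 1 → ContDiffAt ℝ 1 r x) (h1 : ∀ x, ‖x‖ ≤ 1 → ‖r x‖ = 1)
    (hid : ∀ x, ‖x‖ = 1 → r x = x) : False := by
  borelize E
  let μ : Measure E := volume
  let A : E → E →L[ℝ] E := fun x => fderiv ℝ r x - 1
  have hderiv : ∀ x, ‖x‖ ≤ 1 → HasFDerivAt (fun y => r y - y) (A x) x := fun x hx =>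
    ((hr x hx).differentiableAt one_ne_zero).hasFDerivAt.sub (hasFDerivAt_id x)
  have hAcont : ∀ x, ‖x‖ ≤ 1 → ContinuousAt A x := fun x hx =>
    ((hr x hx).fderiv_right (m := 0) (by simp)).continuousAt.sub continuousAt_const
  have hdetcont : ∀ z : ℝ × E, ‖z.2‖ ≤ 1 →
      ContinuousAt (fun z : ℝ × E => (1 + z.1 • A z.2).det) z := fun z hz =>
    ContinuousLinearMap.continuous_det.continuousAt.comp
      (continuousAt_const.add (continuousAt_fst.smul ((hAcont z.2 hz).comp continuousAt_snd)))
  have hint : ∀ t : ℝ, IntegrableOn (fun x => (1 + t • A x).det) (ball 0 1) μ := fun t => by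
    refine (ContinuousOn.integrableOn_compact (isCompact_closedBall 0 1) fun x hx => ?_).mono_set
      ball_subset_closedBall
    exact ((hdetcont (t, x) (mem_closedBall_zero_iff.1 hx)).comp
      (f := fun x : E => (t, x)) (by fun_prop)).continuousWithinAt
  obtain ⟨K, hK⟩ : ∃ K, LipschitzOnWith K (fun y => r y - y) (closedBall 0 1) :=
    ContDiffOn.exists_lipschitzOnWith (n := 1)
      (fun x hx => ((hr x (mem_closedBall_zero_iff.1 hx)).sub contDiffAt_id).contDiffWithinAt)
      one_ne_zero (convex_closedBall 0 1) (isCompact_closedBall 0 1)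
  have hg := hK.indicator_closedBall fun x hx => by simp [hid x hx]
  set g := (closedBall 0 1).indicator fun y => r y - y with hgdef
  have hpos : ∀ᶠ t in 𝓝 (0 : ℝ), ∀ x ∈ closedBall (0 : E) 1, 0 < (1 + t • A x).det := by
    refine (isCompact_closedBall 0 1).eventually_forall_of_forall_eventually
      (P := fun (t : ℝ) (x : E) => 0 < (1 + t • A x).det) fun x hx => ?_
    refine (hdetcont (0, x) (mem_closedBall_zero_iff.1 hx)).eventually (lt_mem_nhds ?_)
    simp [ContinuousLinearMap.det]
  obtain ⟨T, hT, hTpos⟩ := Metric.eventually_nhds_iff.1 hpos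
  have hvol : ∀ t : ℝ, 0 < t → t < min T (1 / (K + 1)) →
      ∫ x in ball 0 1, (1 + t • A x).det ∂μ = μ.real (ball 0 1) := by
    intro t ht htT
    have htK : t * (K + 1) < 1 := (lt_div_iff₀ (by positivity)).1 (htT.trans_le (min_le_right _ _))
    have htg : LipschitzWith (t.toNNReal * K) fun x => t • g x :=
      LipschitzWith.of_dist_le_mul fun x y => by
        rw [dist_smul₀, Real.norm_of_nonneg ht.le, NNReal.coe_mul,
          Real.coe_toNNReal _ ht.le, mul_assoc]
        exact mul_le_mul_of_nonneg_left (hg.dist_le_mul x y) ht.le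
    obtain ⟨hinj, himage⟩ := htg.injective_and_image_eq_of_id_add (s := ball 0 1)
      (by
        rw [← NNReal.coe_lt_coe, NNReal.coe_mul, Real.coe_toNNReal _ ht.le, NNReal.coe_one]
        linarith) fun x hx => by
        rcases (not_lt.1 (mt mem_ball_zero_iff.2 hx)).eq_or_lt with h | h
        · simp [hgdef, ← h, hid x h.symm]
        · simp [hgdef, h.not_ge]
    have hcov := integral_image_eq_integral_abs_det_fderiv_smul μ (s := ball (0 : E) 1)
      measurableSet_ball (f := fun x => x + t • g x) (f' := fun x => 1 + t • A x)
      (fun x hx => by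
        have hx' := (mem_ball_zero_iff.1 hx).le
        refine HasFDerivAt.hasFDerivWithinAt ?_
        refine ((hasFDerivAt_id x).add ((hderiv x hx').const_smul t)).congr_of_eventuallyEq ?_
        filter_upwards [isOpen_ball.mem_nhds hx] with y hy
        simp [hgdef, Set.indicator_of_mem (ball_subset_closedBall hy)])
      hinj.injOn (fun _ => (1 : ℝ))
    rw [himage] at hcov
    rw [← setIntegral_one_eq_measureReal, hcov]
    refine setIntegral_congr_fun measurableSet_ball fun x hx => ?_
    have := hTpos (y := t) (by simpa [abs_of_pos ht] using htT.trans_le (min_le_left _ _)) x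
      (ball_subset_closedBall hx)
    simp [abs_of_pos this]
  have hone := setIntegral_det_one_add_smul_eq_of_forall_small hint (by positivity) hvol 1
  have hzero : ∫ x in ball 0 1, (1 + (1 : ℝ) • A x).det ∂μ = 0 := by
    refine (setIntegral_congr_fun measurableSet_ball fun x hx => ?_).trans
      (integral_zero E ℝ (μ := μ.restrict (ball 0 1)))
    have hx' := mem_ball_zero_iff.1 hx
    simp only [A, one_smul, add_sub_cancel]
    refine ((hr x hx'.le).differentiableAt one_ne_zero).hasFDerivAt
      |>.det_eq_zero_of_eventually_norm_eq_one ?_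
    filter_upwards [isOpen_ball.mem_nhds hx] with y hy
    exact h1 y (mem_ball_zero_iff.1 hy).le
  have hball : 0 < μ.real (ball (0 : E) 1) :=
    ENNReal.toReal_pos (measure_ball_pos μ 0 one_pos).ne' measure_ball_lt_top.ne
  linarith

theorem exists_mem_closedBall_fixedPoint_of_contDiff {p : E → E} (hp : ContDiff ℝ 1 p)
    (hlt : ∀ x, ‖p x‖ < 1) : ∃ x, ‖x‖ ≤ 1 ∧ p x = x := by
  by_contra! hne
  let a : E → ℝ := fun x => ‖x - p x‖ ^ 2
  let b : E → ℝ := fun x => inner ℝ x (x - p x)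
  let D : E → ℝ := fun x => b x ^ 2 + a x * (1 - ‖x‖ ^ 2)
  let r : E → E := fun x => x + ((-b x + √(D x)) / a x) • (x - p x)
  have ha : ∀ x, ‖x‖ ≤ 1 → 0 < a x := fun x hx =>
    pow_pos (norm_pos_iff.2 (sub_ne_zero.2 (hne x hx).symm)) 2
  have hb : ∀ x, ‖x‖ = 1 → 0 < b x := fun x hx => by
    have := real_inner_le_norm x (p x)
    simp only [b, inner_sub_right, real_inner_self_eq_norm_sq, hx] at this ⊢
    linarith [hlt x]
  have hD : ∀ x, ‖x‖ ≤ 1 → 0 < D x := fun x hx => by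
    rcases hx.lt_or_eq with h | h
    · have : 0 < 1 - ‖x‖ ^ 2 := by nlinarith [norm_nonneg x]
      have := mul_pos (ha x hx) this
      positivity
    · have := hb x h
      simp only [D, h]
      norm_num
      positivity
  have hac : ContDiff ℝ 1 a := (contDiff_id.sub hp).norm_sq ℝ
  have hbc : ContDiff ℝ 1 b := contDiff_id.inner ℝ (contDiff_id.sub hp)
  have hDc : ContDiff ℝ 1 D :=
    (hbc.pow 2).add (hac.mul (contDiff_const.sub (contDiff_id.norm_sq ℝ)))
  refine not_forall_contDiffAt_retraction_sphere (r := r) (fun x hx => ?_) (fun x hx => ?_)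
    fun x hx => ?_
  · exact contDiffAt_id.add (((hbc.contDiffAt.neg.add
      (hDc.contDiffAt.sqrt (hD x hx).ne')).div hac.contDiffAt (ha x hx).ne').smul
        (contDiff_id.sub hp).contDiffAt)
  · have hs := Real.sq_sqrt (hD x hx).le
    have ha' := (ha x hx).ne'
    have hsq : ‖r x‖ ^ 2 = 1 := by
      have : ‖r x‖ ^ 2 = ‖x‖ ^ 2 + 2 * ((-b x + √(D x)) / a x) * b x +
          ((-b x + √(D x)) / a x) ^ 2 * a x := by
        simp only [r, norm_add_sq_real, inner_smul_right, norm_smul, mul_pow, Real.norm_eq_abs,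
          sq_abs]
        ring
      rw [this]
      field_simp
      simp only [D] at hs ⊢
      linear_combination hs
    exact (sq_eq_sq₀ (norm_nonneg _) zero_le_one).1 (by simpa using hsq)
  · have : √(D x) = b x := by
      simp only [D, hx]
      norm_num [Real.sqrt_sq (hb x hx).le]
    simp [r, this]

/-- The **Brouwer fixed point theorem** for the closed unit ball. -/
theorem exists_mem_closedBall_fixedPoint {h : E → E} (hc : ContinuousOn h (closedBall 0 1))
    (hm : MapsTo h (closedBall 0 1) (closedBall 0 1)) : ∃ x ∈ closedBall (0 : E) 1, h x = x := by
  by_contra! hne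
  let ρ : E → E := fun x => (max 1 ‖x‖)⁻¹ • x
  have hρc : Continuous ρ := by
    refine Continuous.smul (Continuous.inv₀ (by fun_prop) fun x => ?_) continuous_id
    positivity
  have hρm : ∀ x, ρ x ∈ closedBall (0 : E) 1 := fun x => by
    rw [mem_closedBall_zero_iff, norm_smul, norm_inv, Real.norm_of_nonneg (by positivity)]
    exact inv_mul_le_one_of_le₀ (le_max_right _ _) (by positivity)
  have hρid : ∀ x, ‖x‖ ≤ 1 → ρ x = x := fun x hx => by simp [ρ, hx]
  have hHc : Continuous (h ∘ ρ) := hc.comp_continuous hρc hρm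
  obtain ⟨δ, hδ, hδle⟩ : ∃ δ > 0, ∀ x ∈ closedBall (0 : E) 1, δ ≤ ‖x - h x‖ := by
    obtain ⟨x₀, hx₀, hmin⟩ := (isCompact_closedBall (0 : E) 1).exists_isMinOn
      ⟨0, by simp⟩ (continuousOn_id.sub hc).norm
    exact ⟨_, norm_pos_iff.2 (sub_ne_zero.2 (hne x₀ hx₀).symm), fun x hx => hmin hx⟩
  let η := min δ 1 / 2
  have hη : 0 < η := by positivity
  have hηδ : 2 * η ≤ δ := by simp [η, mul_div_cancel₀]
  have hη1 : 2 * η ≤ 1 := by simp [η, mul_div_cancel₀]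
  obtain ⟨p, hp, hpq, -⟩ := (hHc.const_smul (1 - η)).exists_contDiff_approx 1
    (continuous_const (y := η)) fun _ => hη
  have hHle : ∀ x, ‖h (ρ x)‖ ≤ 1 := fun x => mem_closedBall_zero_iff.1 (hm (hρm x))
  have hpq' : ∀ x, ‖p x - (1 - η) • h (ρ x)‖ < η := fun x => by
    simpa [dist_eq_norm] using hpq x
  obtain ⟨x, hx, hpx⟩ := exists_mem_closedBall_fixedPoint_of_contDiff hp fun x => by
    have h1 := norm_le_norm_sub_add (p x) ((1 - η) • h (ρ x))
    rw [norm_smul, Real.norm_of_nonneg (by linarith)] at h1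
    nlinarith [hHle x, hpq' x]
  have h1 := hpq' x
  have h2 := hδle x (mem_closedBall_zero_iff.2 hx)
  have h3 := hHle x
  rw [hpx, hρid x hx] at h1
  rw [hρid x hx] at h3
  have h4 : ‖x - h x‖ ≤ ‖x - (1 - η) • h x‖ + ‖η • h x‖ := by
    refine (norm_sub_le _ _).trans' (le_of_eq ?_)
    congr 1
    module
  rw [norm_smul, Real.norm_of_nonneg hη.le] at h4
  nlinarith

theorem mem_interior_image_closedBall_of_injOn {f : E → E} (hc : ContinuousOn f (closedBall 0 1))
    (hinj : InjOn f (closedBall 0 1)) : f 0 ∈ interior (f '' closedBall 0 1) := by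
  borelize E
  have h0 : (0 : E) ∈ closedBall (0 : E) 1 := by simp
  have hKc : IsCompact (f '' closedBall 0 1) := (isCompact_closedBall 0 1).image_of_continuousOn hc
  obtain ⟨G, hG⟩ : ∃ G : C(E, E), ∀ x ∈ closedBall (0 : E) 1, G (f x) = x := by
    have : CompactSpace (closedBall (0 : E) 1) :=
      isCompact_iff_compactSpace.1 (isCompact_closedBall 0 1)
    have : TietzeExtension E := TietzeExtension.of_tvs ℝ
    have he := (continuousOn_iff_continuous_domRestrict.1 hc).isClosedEmbedding
      (injOn_iff_injective.1 hinj)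
    obtain ⟨G, hG⟩ := ContinuousMap.exists_extension he
      (⟨Subtype.val, continuous_subtype_val⟩ : C(closedBall (0 : E) 1, E))
    exact ⟨G, fun x hx => DFunLike.congr_fun hG ⟨x, hx⟩⟩
  have hstable : ∀ F : E → E, ContinuousOn F (f '' closedBall 0 1) →
      (∀ x ∈ closedBall (0 : E) 1, ‖x - F (f x)‖ ≤ 1) →
      ∃ x ∈ closedBall (0 : E) 1, F (f x) = 0 := by
    intro F hF hle
    obtain ⟨x, hx, hfix⟩ := exists_mem_closedBall_fixedPoint (h := fun x => x - F (f x))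
      (continuousOn_id.sub (hF.comp hc (mapsTo_image _ _)))
      fun x hx => mem_closedBall_zero_iff.2 (hle x hx)
    exact ⟨x, hx, by simpa using hfix⟩
  by_contra hnot
  obtain ⟨ε, hε, hεG⟩ : ∃ ε > 0, ∀ y, ‖y - f 0‖ ≤ 2 * ε → ‖G y‖ ≤ 1 / 4 := by
    obtain ⟨d, hd, hdG⟩ := Metric.continuousAt_iff.1 (G.continuous.continuousAt (x := f 0)) (1 / 4)
      (by norm_num)
    refine ⟨d / 4, by positivity, fun y hy => ?_⟩
    have := hdG (x := y) (by rw [dist_eq_norm]; linarith)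
    rw [hG 0 h0, dist_zero_right] at this
    exact this.le
  obtain ⟨c, hcK, hcε⟩ : ∃ c ∉ f '' closedBall 0 1, ‖c - f 0‖ < ε := by
    by_contra! hall
    refine hnot (mem_interior_iff_mem_nhds.2 (Metric.mem_nhds_iff.2 ⟨ε, hε, fun y hy => ?_⟩))
    by_contra hyK
    exact (hall y hyK).not_gt (by simpa [dist_eq_norm] using hy)
  obtain ⟨δ, hδ, hδ4, hδG⟩ : ∃ δ > 0, δ ≤ 1 / 4 ∧
      ∀ y ∈ f '' closedBall 0 1, ε ≤ ‖y - c‖ → δ ≤ ‖G y‖ := by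
    have hcpt : IsCompact (f '' closedBall 0 1 ∩ {y | ε ≤ ‖y - c‖}) :=
      hKc.inter_right (isClosed_le continuous_const (by fun_prop))
    rcases (f '' closedBall 0 1 ∩ {y | ε ≤ ‖y - c‖}).eq_empty_or_nonempty with hemp | hne
    · exact ⟨1 / 4, by norm_num, le_rfl, fun y hy hyc =>
        absurd (show y ∈ _ ∩ {y | ε ≤ ‖y - c‖} from ⟨hy, hyc⟩) (by simp [hemp])⟩
    · obtain ⟨y₀, ⟨⟨x₀, hx₀, rfl⟩, hy₀c⟩, hmin⟩ := hcpt.exists_isMinOn hne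
        G.continuous.norm.continuousOn
      have hx₀' : x₀ ≠ 0 := by
        rintro rfl
        rw [mem_ofPred_eq, norm_sub_rev] at hy₀c
        exact hy₀c.not_gt hcε
      refine ⟨min ‖G (f x₀)‖ (1 / 4), ?_, min_le_right _ _, fun y hy hyc =>
        (min_le_left _ _).trans (hmin ⟨hy, hyc⟩)⟩
      rw [hG x₀ hx₀]
      have := norm_pos_iff.2 hx₀'
      positivity
  obtain ⟨P, hPc, hPG, hPS⟩ : ∃ P : E → E, Continuous P ∧ (∀ y, ‖P y - G y‖ < δ) ∧
      ∀ y ∈ sphere c ε, P y ≠ 0 := by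
    obtain ⟨P, hP, hPG, -⟩ := G.continuous.exists_contDiff_approx 1
      (continuous_const (y := δ / 2)) fun _ => by positivity
    have hnull : volume (P '' sphere c ε) = 0 :=
      addHaar_image_eq_zero_of_differentiableOn_of_addHaar_eq_zero volume
        (hP.differentiable one_ne_zero).differentiableOn
        (Measure.addHaar_sphere_of_ne_zero volume c hε.ne')
    obtain ⟨w, hw, hwδ⟩ : ∃ w ∈ (P '' sphere c ε)ᶜ, w ∈ ball (0 : E) (δ / 2) := by
      by_contra! hall
      have hsub : ball (0 : E) (δ / 2) ⊆ P '' sphere c ε := fun w hw =>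
        not_not.1 fun hw' => hall w hw' hw
      exact (measure_ball_pos volume (0 : E) (half_pos hδ)).ne' (measure_mono_null hsub hnull)
    refine ⟨fun y => P y - w, hP.continuous.sub continuous_const, fun y => ?_, fun y hy h => ?_⟩
    · have h1 := hPG y
      rw [dist_eq_norm] at h1
      have h2 := norm_sub_le (P y - G y) w
      rw [sub_right_comm] at h2
      linarith [mem_ball_zero_iff.1 hwδ]
    · exact hw ⟨y, hy, sub_eq_zero.1 h⟩
  let Φ : E → E := fun y => c + max (ε / ‖y - c‖) 1 • (y - c)
  have hΦfar : ∀ y ∈ f '' closedBall 0 1, ε ≤ ‖y - c‖ → Φ y = y := fun y _ hyc => by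
    have : ε / ‖y - c‖ ≤ 1 := div_le_one_of_le₀ hyc (norm_nonneg _)
    simp [Φ, this]
  have hcne : ∀ y ∈ f '' closedBall 0 1, 0 < ‖y - c‖ := fun y hy =>
    norm_pos_iff.2 (sub_ne_zero.2 fun h => hcK (h ▸ hy))
  have hΦnear : ∀ y ∈ f '' closedBall 0 1, ‖y - c‖ < ε → Φ y ∈ sphere c ε := fun y hy hyc => by
    have hpos := hcne y hy
    have : 1 ≤ ε / ‖y - c‖ := (one_le_div hpos).2 hyc.le
    rw [mem_sphere_iff_norm]
    simp only [Φ, add_sub_cancel_left, max_eq_left this, norm_smul]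
    rw [Real.norm_of_nonneg (by positivity), div_mul_cancel₀ _ hpos.ne']
  have hΦc : ContinuousOn Φ (f '' closedBall 0 1) := by
    refine continuousOn_const.add (ContinuousOn.smul (ContinuousOn.sup (ContinuousOn.div
      continuousOn_const (by fun_prop) fun y hy => (hcne y hy).ne') continuousOn_const)
      (by fun_prop))
  obtain ⟨x, hx, hzero⟩ := hstable (P ∘ Φ) (hPc.comp_continuousOn hΦc) fun x hx => by
    have hfx := mem_image_of_mem f hx
    rcases le_or_gt ε ‖f x - c‖ with hfar | hnear
    · have := hPG (f x)
      rw [hG x hx, norm_sub_rev] at this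
      rw [Function.comp_apply, hΦfar _ hfx hfar]
      linarith
    · have hS := mem_sphere_iff_norm.1 (hΦnear _ hfx hnear)
      have h1 := hεG (f x) (by linarith [norm_sub_le_norm_sub_add_norm_sub (f x) c (f 0)])
      rw [hG x hx] at h1
      have h2 := hεG (Φ (f x)) (by
        linarith [norm_sub_le_norm_sub_add_norm_sub (Φ (f x)) c (f 0)])
      have h3 := hPG (Φ (f x))
      have h4 := norm_le_norm_sub_add (P (Φ (f x))) (G (Φ (f x)))
      have h5 := norm_sub_le x (P (Φ (f x)))
      rw [Function.comp_apply]
      linarith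
  have hfx := mem_image_of_mem f hx
  rcases le_or_gt ε ‖f x - c‖ with hfar | hnear
  · rw [Function.comp_apply, hΦfar _ hfx hfar] at hzero
    have := hPG (f x)
    rw [hzero, zero_sub, norm_neg] at this
    exact this.not_ge (hδG _ hfx hfar)
  · exact hPS _ (hΦnear _ hfx hnear) hzero

theorem IsOpen.image_of_continuousOn_of_injOn_of_inner {f : E → E} {U : Set E} (hU : IsOpen U)
    (hc : ContinuousOn f U) (hinj : InjOn f U) : IsOpen (f '' U) := by
  rw [isOpen_iff_mem_nhds]
  rintro _ ⟨x, hx, rfl⟩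
  obtain ⟨ρ, hρ, hball⟩ := Metric.nhds_basis_closedBall.mem_iff.1 (hU.mem_nhds hx)
  have hmaps : MapsTo (fun y : E => x + ρ • y) (closedBall 0 1) U := fun y hy => hball <| by
    rw [mem_closedBall_zero_iff] at hy
    rw [mem_closedBall_iff_norm, add_sub_cancel_left, norm_smul, Real.norm_of_nonneg hρ.le]
    nlinarith
  have := mem_interior_image_closedBall_of_injOn (f := fun y => f (x + ρ • y))
    (hc.comp (by fun_prop) hmaps) (hinj.comp (fun y _ z _ h => by
      simpa [hρ.ne'] using h) hmaps)
  simp only [smul_zero, add_zero] at this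
  refine Filter.mem_of_superset (mem_interior_iff_mem_nhds.1 this) ?_
  rintro _ ⟨y, hy, rfl⟩
  exact mem_image_of_mem f (hmaps hy)

theorem continuousOn_invFun_comp_comp {X Y M : Type*} [TopologicalSpace X] [TopologicalSpace Y]
    [Nonempty Y] [TopologicalSpace M] {f : M → M} {e : X → M} {e' : Y → M} (hf : Continuous f)
    (he : Continuous e) (he' : IsInducing e') :
    ContinuousOn (fun x => Function.invFun e' (f (e x))) ((f ∘ e) ⁻¹' range e') := by
  rw [he'.continuousOn_iff]
  exact (hf.comp he).continuousOn.congr fun x hx => Function.invFun_eq hx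

theorem Function.Injective.injOn_invFun_comp_comp {X Y M : Type*} [Nonempty Y] {f : M → M}
    {e : X → M} {e' : Y → M} (hinj : Function.Injective f) (he : Function.Injective e) :
    InjOn (fun x => Function.invFun e' (f (e x))) ((f ∘ e) ⁻¹' range e') := fun x hx y hy h =>
  he <| hinj <| calc
    f (e x) = e' (Function.invFun e' (f (e x))) := (Function.invFun_eq hx).symm
    _ = e' (Function.invFun e' (f (e y))) := congrArg e' h
    _ = f (e y) := Function.invFun_eq hy

variable {X Y : Type*} [NormedAddCommGroup X] [NormedSpace ℝ X] [FiniteDimensional ℝ X]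
  [NormedAddCommGroup Y] [NormedSpace ℝ Y] [FiniteDimensional ℝ Y]

/-- Brouwer's **invariance of domain**. -/
theorem IsOpen.image_of_continuousOn_of_injOn {f : X → Y} {U : Set X}
    (hXY : Module.finrank ℝ X = Module.finrank ℝ Y) (hU : IsOpen U) (hc : ContinuousOn f U)
    (hinj : InjOn f U) : IsOpen (f '' U) := by
  let e : X ≃L[ℝ] EuclideanSpace ℝ (Fin (Module.finrank ℝ X)) := toEuclidean
  let e' : Y ≃L[ℝ] EuclideanSpace ℝ (Fin (Module.finrank ℝ X)) :=
    ContinuousLinearEquiv.ofFinrankEq (by simp [hXY])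
  have hmaps : MapsTo e.symm (e.symm ⁻¹' U) U := mapsTo_preimage _ _
  have := (hU.preimage e.symm.continuous).image_of_continuousOn_of_injOn_of_inner
    (f := fun x => e' (f (e.symm x)))
    (e'.continuous.comp_continuousOn (hc.comp e.symm.continuous.continuousOn hmaps))
    (e'.injective.comp_injOn (hinj.comp e.symm.injective.injOn hmaps))
  have himage : (fun x => e' (f (e.symm x))) '' (e.symm ⁻¹' U) = e' '' (f '' U) := by
    rw [image_image]
    conv_rhs => rw [← image_preimage_eq U e.symm.surjective, image_image]
  rw [himage] at this
  exact e'.toHomeomorph.isOpen_image.1 this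

theorem finrank_le_of_continuousOn_of_injOn {f : X → Y} {U : Set X} (hU : IsOpen U)
    (hne : U.Nonempty) (hc : ContinuousOn f U) (hinj : InjOn f U) :
    Module.finrank ℝ X ≤ Module.finrank ℝ Y := by
  by_contra! hlt
  obtain ⟨ι, hι⟩ := finrank_le_iff_exists_linearMap.1 hlt.le
  have hopen := hU.image_of_continuousOn_of_injOn (f := ι ∘ f) rfl
    (ι.continuous_of_finiteDimensional.comp_continuousOn hc) (hι.comp_injOn hinj)
  have htop : LinearMap.range ι = ⊤ := by
    refine Submodule.eq_top_of_nonempty_interior' _ ((hne.image (ι ∘ f)).mono ?_)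
    refine interior_maximal ?_ hopen
    rintro _ ⟨x, _, rfl⟩
    exact ⟨f x, rfl⟩
  have := ι.finrank_range_le
  rw [htop, finrank_top] at this
  exact hlt.not_ge this

variable {M : Type*} [TopologicalSpace M] {f : M → M} {e : X → M} {e' : Y → M}

theorem finrank_le_of_isOpenEmbedding (he : IsOpenEmbedding e) (he' : IsOpenEmbedding e')
    (hmeet : (range e ∩ range e').Nonempty) : Module.finrank ℝ X ≤ Module.finrank ℝ Y := by
  obtain ⟨_, ⟨p, rfl⟩, hp⟩ := hmeet
  exact finrank_le_of_continuousOn_of_injOn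
    (he'.isOpen_range.preimage (continuous_id.comp he.continuous)) ⟨p, hp⟩
    (continuousOn_invFun_comp_comp continuous_id he.continuous he'.isInducing)
    (Function.injective_id.injOn_invFun_comp_comp he.injective)

theorem range_mem_nhds_of_isOpenEmbedding (hXY : Module.finrank ℝ X = Module.finrank ℝ Y)
    (hf : Continuous f) (hinj : Function.Injective f) (he : IsOpenEmbedding e)
    (he' : IsOpenEmbedding e') {p : X} (hp : f (e p) ∈ range e') : range f ∈ 𝓝 (f (e p)) := by
  have hopen := he'.isOpenMap _ <| IsOpen.image_of_continuousOn_of_injOn hXY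
    (he'.isOpen_range.preimage (hf.comp he.continuous))
    (continuousOn_invFun_comp_comp hf he.continuous he'.isInducing)
    (hinj.injOn_invFun_comp_comp he.injective)
  refine Filter.mem_of_superset (hopen.mem_nhds
    ⟨_, mem_image_of_mem _ (show p ∈ (f ∘ e) ⁻¹' range e' from hp), Function.invFun_eq hp⟩) ?_
  rintro _ ⟨_, ⟨x, hx, rfl⟩, rfl⟩
  exact ⟨e x, (Function.invFun_eq hx).symm⟩

theorem exists_forall_exists_isOpenEmbedding_fin [ConnectedSpace M]
    (hloc : ∀ x : M, ∃ (n : ℕ) (e : (Fin n → ℝ) → M), IsOpenEmbedding e ∧ x ∈ range e) :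
    ∃ n : ℕ, ∀ x : M, ∃ e : (Fin n → ℝ) → M, IsOpenEmbedding e ∧ x ∈ range e := by
  choose d e he hmem using hloc
  have hd : IsLocallyConstant d := (IsLocallyConstant.iff_eventually_eq d).2 fun x => by
    filter_upwards [(he x).isOpen_range.mem_nhds (hmem x)] with y hy
    refine le_antisymm ?_ ?_
    · simpa using finrank_le_of_isOpenEmbedding (he y) (he x) ⟨y, hmem y, hy⟩
    · simpa using finrank_le_of_isOpenEmbedding (he x) (he y) ⟨y, hy, hmem y⟩
  obtain ⟨x₀⟩ : Nonempty M := inferInstance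
  refine ⟨d x₀, fun x => ?_⟩
  rw [← hd.apply_eq_of_isPreconnected isPreconnected_univ (mem_univ x) (mem_univ x₀)]
  exact ⟨e x, he x, hmem x⟩

end InvarianceOfDomain

/-- Every injective continuous self-map of a compact connected Hausdorff topological
manifold (every point has an open neighborhood homeomorphic to some `ℝⁿ`) is
surjective. -/
theorem injective_continuous_self_map_of_compact_manifold_surjective
    {M : Type*} [TopologicalSpace M] [CompactSpace M] [ConnectedSpace M] [T2Space M]
    (hloc : ∀ x : M, ∃ (n : ℕ) (U : Set M),
      IsOpen U ∧ x ∈ U ∧ Nonempty (U ≃ₜ (Fin n → ℝ)))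
    (f : M → M) (hf : Continuous f) (hinj : Function.Injective f) :
    Function.Surjective f := by
  have hloc' : ∀ x : M, ∃ (n : ℕ) (e : (Fin n → ℝ) → M),
      Topology.IsOpenEmbedding e ∧ x ∈ Set.range e := fun x => by
    obtain ⟨n, U, hU, hx, ⟨φ⟩⟩ := hloc x
    exact ⟨n, Subtype.val ∘ φ.symm, hU.isOpenEmbedding_subtypeVal.comp φ.symm.isOpenEmbedding,
      φ ⟨x, hx⟩, by simp⟩
  obtain ⟨n, hn⟩ := exists_forall_exists_isOpenEmbedding_fin hloc'
  have hopen : IsOpen (Set.range f) := isOpen_iff_mem_nhds.2 <| by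
    rintro _ ⟨x, rfl⟩
    obtain ⟨e, he, p, rfl⟩ := hn x
    obtain ⟨e', he', hp⟩ := hn (f (e p))
    exact range_mem_nhds_of_isOpenEmbedding rfl hf hinj he he' hp
  exact Set.range_eq_univ.1 <|
    IsClopen.eq_univ ⟨(isCompact_range hf).isClosed, hopen⟩ (Set.range_nonempty f)
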